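/- Let (X, 𝒳, μ, T) be a measure preserving system for which there exists a bounded function g ∈ L^∞(μ) with ‖g‖_{L²(μ)} = 1 and ∫ g · (g∘Tⁿ) dμ = 0 for every n ≥ 1 (a Lebesgue component defined by a bounded function). Then for any partition ℕ = S₊ ∪ S₋ there exists a bounded measurable function f : X → [0,1] such that ∫ f · (f∘Tⁿ) dμ > (∫ f dμ)² for every n ∈ S₊ and ∫ f · (f∘Tⁿ) dμ < (∫ f dμ)² for every n ∈ S₋. -/

import Mathlib

open MeasureTheory Filter Topology

lemma integrable_of_abs_le {X : Type*} [MeasurableSpace X] {μ : Measure X}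
    [IsFiniteMeasure μ] {h : X → ℝ} (hm : Measurable h) {D : ℝ} (hD : ∀ x, |h x| ≤ D) :
    Integrable h μ :=
  Integrable.of_bound hm.aestronglyMeasurable D (ae_of_all _ hD)

lemma hasSum_integral_mul_of_bounded {X : Type*} [MeasurableSpace X] (μ : Measure X)
    [IsProbabilityMeasure μ] {a : ℕ → ℝ} (ha : Summable fun k => |a k|)
    {u : ℕ → X → ℝ} (hum : ∀ k, Measurable (u k)) {C : ℝ} (hC : ∀ k x, |u k x| ≤ C)
    {h : X → ℝ} (hm : Measurable h) {D : ℝ} (hD : ∀ x, |h x| ≤ D) :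
    HasSum (fun k => a k * ∫ x, u k x * h x ∂μ) (∫ x, (∑' k, a k * u k x) * h x ∂μ) := by
  have hbound : ∀ k x, ‖a k * (u k x * h x)‖ ≤ |a k| * (C * D) := fun k x => by
    rw [Real.norm_eq_abs, abs_mul, abs_mul]
    have := (abs_nonneg _).trans (hC k x)
    gcongr
    exacts [hC k x, hD x]
  have hint : ∀ k, Integrable (fun x => a k * (u k x * h x)) μ := fun k =>
    integrable_of_abs_le (((hum k).mul hm).const_mul _) (hbound k)
  have key := hasSum_integral_of_summable_integral_norm (μ := μ) hint
    (Summable.of_nonneg_of_le (fun k => integral_nonneg fun x => norm_nonneg _)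
      (fun k => by
        refine (integral_mono (hint k).norm (integrable_const _) (hbound k)).trans ?_
        simp) (ha.mul_right (C * D)))
  simp only [integral_const_mul] at key
  simpa only [← tsum_mul_right, mul_assoc] using key

lemma abs_tsum_shift_mul_lt {a : ℕ → ℝ} (ha : ∀ k, |a k| = (1 / 2) ^ k) (n : ℕ) :
    |∑' k, a (k + 1 + n) * a (k + 1)| < (1 / 2 : ℝ) ^ n := by
  have hs : HasSum (fun k : ℕ => (1 / 2 : ℝ) ^ n * (1 / 4) * (1 / 4) ^ k)
      ((1 / 2 : ℝ) ^ n * (1 / 4) * (1 - 1 / 4)⁻¹) :=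
    (hasSum_geometric_of_lt_one (by norm_num) (by norm_num)).mul_left _
  have h := tsum_of_norm_bounded hs (f := fun k => a (k + 1 + n) * a (k + 1)) fun k => by
    rw [Real.norm_eq_abs, abs_mul, ha, ha]
    apply le_of_eq
    rw [show (1 / 4 : ℝ) = (1 / 2) ^ 2 by norm_num, ← pow_mul]
    ring
  rw [Real.norm_eq_abs] at h
  refine h.trans_lt ?_
  have : (0 : ℝ) < (1 / 2) ^ n := by positivity
  rw [show (1 - 1 / 4 : ℝ)⁻¹ = 4 / 3 by norm_num]
  linarith

lemma integral_comp_iterate {X : Type*} [MeasurableSpace X] {μ : Measure X} {T : X → X}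
    (hT : MeasurePreserving T μ μ) {h : X → ℝ} (hm : Measurable h) (k : ℕ) :
    ∫ x, h (T^[k] x) ∂μ = ∫ x, h x ∂μ := by
  have hk := hT.iterate k
  conv_rhs => rw [← hk.map_eq]
  rw [integral_map hk.measurable.aemeasurable hm.aestronglyMeasurable]

section Orthonormal

variable {X : Type*} [MeasurableSpace X] {μ : Measure X} {T : X → X} {g : X → ℝ}

lemma integral_iterate_mul_iterate (hT : MeasurePreserving T μ μ) (hgm : Measurable g)
    (hgnorm : (∫ x, g x ^ 2 ∂μ) = 1)
    (hgorth : ∀ n : ℕ, 1 ≤ n → (∫ x, g x * g (T^[n] x) ∂μ) = 0) (i j : ℕ) :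
    ∫ x, g (T^[i] x) * g (T^[j] x) ∂μ = if i = j then 1 else 0 := by
  wlog hij : i ≤ j generalizing i j
  · simp_rw [mul_comm (g (T^[i] _)), this j i (by omega), eq_comm]
  obtain ⟨d, rfl⟩ := Nat.exists_eq_add_of_le' hij
  have := integral_comp_iterate hT
    (hgm.mul (hgm.comp (hT.iterate d).measurable)) i
  simp only [Pi.mul_apply, Function.comp_apply, ← Function.iterate_add_apply] at this
  rw [this]
  rcases Nat.eq_zero_or_pos d with rfl | hd
  · simpa [pow_two] using hgnorm
  · rw [hgorth d hd, if_neg (by omega)]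

variable [IsProbabilityMeasure μ]

lemma integral_eq_zero_of_orthonormal_iterates (hT : MeasurePreserving T μ μ)
    (hgm : Measurable g) {C : ℝ} (hC : ∀ x, |g x| ≤ C)
    (hgnorm : (∫ x, g x ^ 2 ∂μ) = 1)
    (hgorth : ∀ n : ℕ, 1 ≤ n → (∫ x, g x * g (T^[n] x) ∂μ) = 0) :
    ∫ x, g x ∂μ = 0 := by
  have hm : ∀ k, Measurable fun x => g (T^[k] x) := fun k =>
    hgm.comp (hT.iterate k).measurable
  have hi : ∀ k, Integrable (fun x => g (T^[k] x)) μ := fun k =>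
    integrable_of_abs_le (hm k) fun x => hC _
  have hii : ∀ i j, Integrable (fun x => g (T^[i] x) * g (T^[j] x)) μ := fun i j =>
    integrable_of_abs_le ((hm i).mul (hm j)) (D := C * C) fun x => by
      rw [abs_mul]
      have := (abs_nonneg _).trans (hC x)
      gcongr <;> exact hC _
  set m := ∫ x, g x ∂μ with hmdef
  have hb : ∀ N : ℕ, (N : ℝ) * m ^ 2 ≤ 1 := fun N => by
    have hsq : ∀ x, (∑ k ∈ Finset.range N, g (T^[k] x) - N * m) ^ 2
        = ∑ i ∈ Finset.range N, ∑ j ∈ Finset.range N, g (T^[i] x) * g (T^[j] x)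
          - 2 * (N * m) * ∑ k ∈ Finset.range N, g (T^[k] x) + (N * m) ^ 2 := fun x => by
      rw [← Finset.sum_mul_sum]; ring
    have h0 : 0 ≤ ∫ x, (∑ k ∈ Finset.range N, g (T^[k] x) - N * m) ^ 2 ∂μ :=
      integral_nonneg fun x => sq_nonneg _
    have hI1 : Integrable (fun x => ∑ k ∈ Finset.range N, g (T^[k] x)) μ :=
      integrable_finsetSum _ fun k _ => hi k
    have hI2 : Integrable (fun x => ∑ i ∈ Finset.range N, ∑ j ∈ Finset.range N,
        g (T^[i] x) * g (T^[j] x)) μ :=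
      integrable_finsetSum _ fun i _ => integrable_finsetSum _ fun j _ => hii i j
    simp_rw [hsq] at h0
    have hI3 : Integrable (fun x => ∑ i ∈ Finset.range N, ∑ j ∈ Finset.range N,
        g (T^[i] x) * g (T^[j] x) - 2 * (N * m) * ∑ k ∈ Finset.range N, g (T^[k] x)) μ :=
      hI2.sub (hI1.const_mul _)
    rw [integral_add hI3 (integrable_const _),
      integral_sub hI2 (hI1.const_mul _), integral_const_mul,
      integral_finsetSum _ fun k _ => hi k,
      integral_finsetSum _ fun i _ => integrable_finsetSum _ fun j _ => hii i j] at h0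
    simp_rw [integral_finsetSum _ fun j _ => hii _ j,
      integral_iterate_mul_iterate hT hgm hgnorm hgorth,
      integral_comp_iterate hT hgm, ← hmdef] at h0
    have hdiag : ∑ i ∈ Finset.range N, ∑ j ∈ Finset.range N,
        (if i = j then (1 : ℝ) else 0) = N := by
      rw [Finset.sum_congr rfl (g := fun _ => (1 : ℝ))]
      · simp
      · intro i hi
        rw [Finset.sum_ite_eq, if_pos hi]
    rw [hdiag] at h0
    simp only [Finset.sum_const, Finset.card_range, nsmul_eq_mul, integral_const, probReal_univ,
      smul_eq_mul, one_mul] at h0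
    rcases Nat.eq_zero_or_pos N with rfl | hN
    · simp
    · have hN' : (0 : ℝ) < N := by exact_mod_cast hN
      by_contra! hcon
      nlinarith
  by_contra hne
  have hpos : 0 < m ^ 2 := by positivity
  obtain ⟨N, hN⟩ := exists_nat_gt (1 / m ^ 2)
  rw [div_lt_iff₀ hpos] at hN
  linarith [hb N]

lemma integral_tsum_mul_tsum_iterate (hT : MeasurePreserving T μ μ)
    (hgm : Measurable g) {C : ℝ} (hC : ∀ x, |g x| ≤ C)
    (hgnorm : (∫ x, g x ^ 2 ∂μ) = 1)
    (hgorth : ∀ n : ℕ, 1 ≤ n → (∫ x, g x * g (T^[n] x) ∂μ) = 0)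
    {a : ℕ → ℝ} (ha : Summable fun k => |a k|)
    (hφm : Measurable fun x => ∑' k, a k * g (T^[k] x)) {D : ℝ}
    (hφ : ∀ x, |∑' k, a k * g (T^[k] x)| ≤ D) (n : ℕ) :
    HasSum (fun k => a (k + n) * a k)
      (∫ x, (∑' k, a k * g (T^[k] x)) * (∑' k, a k * g (T^[k] (T^[n] x))) ∂μ) := by
  have hm : ∀ k, Measurable fun x => g (T^[k] x) := fun k =>
    hgm.comp (hT.iterate k).measurable
  have hcoef : ∀ i, ∫ x, g (T^[i] x) * (∑' k, a k * g (T^[k] (T^[n] x))) ∂μ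
      = if n ≤ i then a (i - n) else 0 := fun i => by
    have h := hasSum_integral_mul_of_bounded μ ha
      (u := fun k x => g (T^[k] (T^[n] x))) (C := C)
      (fun k => (hm k).comp (hT.iterate n).measurable) (fun k x => hC _)
      (hm i) (fun x => hC _)
    simp_rw [← Function.iterate_add_apply,
      integral_iterate_mul_iterate hT hgm hgnorm hgorth] at h
    simp_rw [mul_comm (g (T^[i] _)), ← Function.iterate_add_apply]
    refine h.unique ?_
    split_ifs with hni
    · convert hasSum_single (i - n) ?_ using 1
      · rw [if_pos (by omega), mul_one]
      · intro k hk
        rw [if_neg (by omega), mul_zero]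
    · convert hasSum_zero using 2 with k
      rw [if_neg (by omega), mul_zero]
  have h := hasSum_integral_mul_of_bounded μ ha (u := fun k x => g (T^[k] x)) hm
    (fun k x => hC _) (hφm.comp (hT.iterate n).measurable) (fun x => hφ (T^[n] x))
  simp only [Function.comp_apply, hcoef] at h
  rw [← hasSum_nat_add_iff' n, Finset.sum_eq_zero, sub_zero] at h
  · simpa using h
  · intro i hi
    rw [if_neg (by simpa using hi), mul_zero]

end Orthonormal

theorem stmt_10 {X : Type*} [MeasurableSpace X] (μ : Measure X) [IsProbabilityMeasure μ]
    (T : X → X) (hT : MeasurePreserving T μ μ)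
    (g : X → ℝ) (hgm : Measurable g) (hgbdd : ∃ C : ℝ, ∀ x, |g x| ≤ C)
    (hgnorm : (∫ x, g x ^ 2 ∂μ) = 1)
    (hgorth : ∀ n : ℕ, 1 ≤ n → (∫ x, g x * g (T^[n] x) ∂μ) = 0)
    (S : Set ℕ) :
    ∃ f : X → ℝ, Measurable f ∧ (∀ x, f x ∈ Set.Icc (0 : ℝ) 1) ∧
      ∀ n : ℕ, 1 ≤ n →
        (n ∈ S → (∫ x, f x * f (T^[n] x) ∂μ) > (∫ x, f x ∂μ) ^ 2) ∧
        (n ∉ S → (∫ x, f x * f (T^[n] x) ∂μ) < (∫ x, f x ∂μ) ^ 2) := by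
  classical
  obtain ⟨C, hC⟩ := hgbdd
  set a : ℕ → ℝ := fun k => if k = 0 ∨ k ∈ S then (1 / 2) ^ k else -(1 / 2) ^ k with ha_def
  have habs : ∀ k, |a k| = (1 / 2) ^ k := fun k => by
    simp only [ha_def]
    split_ifs
    · exact abs_of_nonneg (by positivity)
    · rw [abs_neg]; exact abs_of_nonneg (by positivity)
  have ha : Summable fun k => |a k| := by simp_rw [habs]; exact summable_geometric_two
  have hm : ∀ k, Measurable fun x => g (T^[k] x) := fun k =>
    hgm.comp (hT.iterate k).measurable
  set φ : X → ℝ := fun x => ∑' k, a k * g (T^[k] x) with hφ_def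
  have hterm : ∀ x k, ‖a k * g (T^[k] x)‖ ≤ (1 / 2) ^ k * C := fun x k => by
    rw [Real.norm_eq_abs, abs_mul, habs]
    gcongr
    exact hC _
  have hφm : Measurable φ := Measurable.tsum fun k => (hm k).const_mul _
  have hφb : ∀ x, |φ x| ≤ 2 * C := fun x =>
    tsum_of_norm_bounded (hasSum_geometric_two.mul_right C) (hterm x)
  have hmean : ∫ x, φ x ∂μ = 0 := by
    have h := hasSum_integral_mul_of_bounded μ ha (u := fun k x => g (T^[k] x)) hm
      (fun k x => hC _) (h := fun _ => 1) measurable_const (D := 1) (by simp)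
    simp only [mul_one, integral_comp_iterate hT hgm,
      integral_eq_zero_of_orthonormal_iterates hT hgm hC hgnorm hgorth, mul_zero] at h
    exact h.unique hasSum_zero
  have hcorr : ∀ n, ∃ r, |r| < (1 / 2 : ℝ) ^ n ∧
      ∫ x, φ x * φ (T^[n] x) ∂μ = a n + r := fun n => by
    have h := integral_tsum_mul_tsum_iterate hT hgm hC hgnorm hgorth ha hφm hφb n
    refine ⟨_, abs_tsum_shift_mul_lt habs n, ?_⟩
    rw [← h.tsum_eq, h.summable.tsum_eq_zero_add]
    simp [ha_def]
  have hC0 : 0 ≤ C := by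
    have : Nonempty X := nonempty_of_isProbabilityMeasure μ
    exact (abs_nonneg _).trans (hC (Classical.arbitrary X))
  obtain ⟨c, hc, hcb⟩ : ∃ c : ℝ, 0 < c ∧ c * (2 * C) ≤ 1 / 2 := by
    refine ⟨1 / (4 * (C + 1)), by positivity, ?_⟩
    rw [div_mul_eq_mul_div, div_le_div_iff₀ (by positivity) (by norm_num)]
    linarith
  have hφi : Integrable φ μ := integrable_of_abs_le hφm hφb
  have hφim : ∀ n, Integrable (fun x => φ (T^[n] x)) μ := fun n =>
    integrable_of_abs_le (hφm.comp (hT.iterate n).measurable) fun x => hφb _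
  have hφii : ∀ n, Integrable (fun x => φ x * φ (T^[n] x)) μ := fun n =>
    integrable_of_abs_le (hφm.mul (hφm.comp (hT.iterate n).measurable))
      (D := 2 * C * (2 * C)) fun x => by
      rw [abs_mul]
      gcongr <;> exact hφb _
  refine ⟨fun x => 1 / 2 + c * φ x, (hφm.const_mul c).const_add _, fun x => ?_, fun n hn => ?_⟩
  · have : |c * φ x| ≤ 1 / 2 := by
      rw [abs_mul, abs_of_pos hc]
      exact (mul_le_mul_of_nonneg_left (hφb x) hc.le).trans hcb
    rw [abs_le] at this
    constructor <;> linarith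
  · have hI : ∫ x, (1 / 2 + c * φ x) ∂μ = 1 / 2 := by
      rw [integral_add (integrable_const _) (hφi.const_mul c), integral_const_mul, hmean]
      simp
    have hII : ∫ x, (1 / 2 + c * φ x) * (1 / 2 + c * φ (T^[n] x)) ∂μ
        = (1 / 2) ^ 2 + c ^ 2 * ∫ x, φ x * φ (T^[n] x) ∂μ := by
      have hexp : ∀ x, (1 / 2 + c * φ x) * (1 / 2 + c * φ (T^[n] x))
          = ((1 / 2) ^ 2 + c / 2 * φ x) + (c / 2 * φ (T^[n] x)
            + c ^ 2 * (φ x * φ (T^[n] x))) := fun x => by ring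
      simp_rw [hexp]
      have hJ1 : Integrable (fun x => (1 / 2) ^ 2 + c / 2 * φ x) μ :=
        (integrable_const _).add (hφi.const_mul _)
      have hJ2 : Integrable (fun x => c / 2 * φ (T^[n] x) + c ^ 2 * (φ x * φ (T^[n] x))) μ :=
        ((hφim n).const_mul _).add ((hφii n).const_mul _)
      rw [integral_add hJ1 hJ2,
        integral_add (integrable_const _) (hφi.const_mul _),
        integral_add ((hφim n).const_mul _) ((hφii n).const_mul _),
        integral_const_mul, integral_const_mul, integral_const_mul,
        integral_comp_iterate hT hφm, hmean]
      simp
    obtain ⟨r, hr, hr'⟩ := hcorr n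
    rw [abs_lt] at hr
    rw [hI, hII, hr']
    have hc2 : 0 < c ^ 2 := by positivity
    refine ⟨fun hS => ?_, fun hS => ?_⟩
    · have : a n = (1 / 2) ^ n := if_pos (Or.inr hS)
      have := mul_pos hc2 (show 0 < a n + r by linarith)
      linarith
    · have : a n = -(1 / 2) ^ n := if_neg (by rintro (h | h); exacts [by omega, hS h])
      have := mul_neg_of_pos_of_neg hc2 (show a n + r < 0 by linarith)
      linarith
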